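/- Let F = conv{y_1,…,y_d} ⊂ ℝ^d be a (d−1)-dimensional simplex (the points y_1,…,y_d are affinely independent). Then for every t ∈ ℝ^d satisfying ⟨y_k, t⟩ < 1 for all k = 1,…,d, one has ∫_F (1 − ⟨x, t⟩)^{−d} H^{d−1}(dx) = H^{d−1}(F) / ∏_{k=1}^{d} (1 − ⟨y_k, t⟩), where H^{d−1} denotes (d−1)-dimensional Hausdorff measure on ℝ^d. -/

import Mathlib

open MeasureTheory Module

/-- The corner simplex `{u | 0 ≤ u, ∑ i, u i ≤ 1}` in Euclidean space. -/
def cornerSimplex (n : ℕ) : Set (EuclideanSpace ℝ (Fin n)) :=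
  {u | (∀ i, 0 ≤ u i) ∧ ∑ i, u i ≤ 1}

lemma isClosed_cornerSimplex (n : ℕ) : IsClosed (cornerSimplex n) := by
  have h : cornerSimplex n =
      (⋂ i, {u : EuclideanSpace ℝ (Fin n) | 0 ≤ u i}) ∩ {u | ∑ i, u i ≤ 1} := by
    ext u
    simp [cornerSimplex]
  rw [h]
  exact (isClosed_iInter fun i => isClosed_le (by fun_prop) (by fun_prop)).inter
    (isClosed_le (by fun_prop) (by fun_prop))

/-- The affine function on the corner simplex with value `b` at the origin and `a i` at the
`i`-th standard basis vector. -/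
def vertexInterp {n : ℕ} (b : ℝ) (a : Fin n → ℝ) (u : EuclideanSpace ℝ (Fin n)) : ℝ :=
  b + ∑ i, u i * (a i - b)

lemma vertexInterp_eq {n : ℕ} (b : ℝ) (a : Fin n → ℝ) (u : EuclideanSpace ℝ (Fin n)) :
    vertexInterp b a u = b * (1 - ∑ i, u i) + ∑ i, u i * a i := by
  simp only [vertexInterp, mul_sub, Finset.sum_sub_distrib, ← Finset.sum_mul]
  ring

lemma vertexInterp_pos {n : ℕ} {b : ℝ} {a : Fin n → ℝ} (hb : 0 < b) (ha : ∀ i, 0 < a i)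
    {u : EuclideanSpace ℝ (Fin n)} (hu : u ∈ cornerSimplex n) : 0 < vertexInterp b a u := by
  rw [vertexInterp_eq]
  have h0 : ∀ i ∈ Finset.univ, 0 ≤ u i * a i := fun i _ => mul_nonneg (hu.1 i) (ha i).le
  rcases hu.2.lt_or_eq with h | h
  · have := Finset.sum_nonneg h0
    have : 0 < b * (1 - ∑ i, u i) := mul_pos hb (by linarith)
    linarith
  · rw [h]
    have : 0 < ∑ i, u i * a i := by
      refine (Finset.sum_nonneg h0).lt_of_ne' fun h1 => ?_
      rw [Finset.sum_eq_zero_iff_of_nonneg h0] at h1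
      have : ∑ i, u i = 0 := Finset.sum_eq_zero fun i hi =>
        (mul_eq_zero.1 (h1 i hi)).resolve_right (ha i).ne'
      linarith
    linarith

/-- The coordinatewise scaling of Euclidean space. -/
noncomputable def coordScale {n : ℕ} (a : Fin n → ℝ) :
    EuclideanSpace ℝ (Fin n) →ₗ[ℝ] EuclideanSpace ℝ (Fin n) :=
  Matrix.toLin (EuclideanSpace.basisFun (Fin n) ℝ).toBasis
    (EuclideanSpace.basisFun (Fin n) ℝ).toBasis (Matrix.diagonal a)

lemma coordScale_apply {n : ℕ} (a : Fin n → ℝ) (u : EuclideanSpace ℝ (Fin n)) (i : Fin n) :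
    coordScale a u i = a i * u i := by
  simp [coordScale, Matrix.toLin_apply, Matrix.mulVec_diagonal, Pi.single_apply]

lemma det_coordScale {n : ℕ} (a : Fin n → ℝ) : LinearMap.det (coordScale a) = ∏ i, a i := by
  simp [coordScale, LinearMap.det_toLin]

/-- The projective self-map of the corner simplex that fixes the vertices and rescales
barycentric coordinates by the weights `b, a`. -/
noncomputable def projScale {n : ℕ} (b : ℝ) (a : Fin n → ℝ) (u : EuclideanSpace ℝ (Fin n)) :
    EuclideanSpace ℝ (Fin n) :=
  (vertexInterp b a u)⁻¹ • coordScale a u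

lemma projScale_apply {n : ℕ} (b : ℝ) (a : Fin n → ℝ) (u : EuclideanSpace ℝ (Fin n))
    (i : Fin n) : projScale b a u i = (vertexInterp b a u)⁻¹ * (a i * u i) := by
  simp [projScale, coordScale_apply]

lemma one_sub_sum_projScale {n : ℕ} {b : ℝ} {a : Fin n → ℝ} {u : EuclideanSpace ℝ (Fin n)}
    (h : vertexInterp b a u ≠ 0) :
    1 - ∑ i, projScale b a u i = (vertexInterp b a u)⁻¹ * (b * (1 - ∑ i, u i)) := by
  have h1 : ∑ i, projScale b a u i = (vertexInterp b a u)⁻¹ * ∑ i, u i * a i := by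
    simp_rw [projScale_apply, Finset.mul_sum, mul_comm (a _)]
  have h2 : ∑ i, u i * a i = vertexInterp b a u - b * (1 - ∑ i, u i) := by
    rw [vertexInterp_eq]; ring
  rw [h1, h2]
  field_simp
  ring

lemma projScale_mem {n : ℕ} {b : ℝ} {a : Fin n → ℝ} (hb : 0 < b) (ha : ∀ i, 0 < a i)
    {u : EuclideanSpace ℝ (Fin n)} (hu : u ∈ cornerSimplex n) :
    projScale b a u ∈ cornerSimplex n := by
  have hS := vertexInterp_pos hb ha hu
  constructor
  · intro i
    rw [projScale_apply]
    have := hu.1 i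
    have := ha i
    positivity
  · have h : 0 ≤ 1 - ∑ i, projScale b a u i := by
      rw [one_sub_sum_projScale hS.ne']
      have : 0 ≤ 1 - ∑ i, u i := by linarith [hu.2]
      positivity
    linarith

lemma projScale_inv_projScale {n : ℕ} {b : ℝ} {a : Fin n → ℝ} (hb : 0 < b) (ha : ∀ i, 0 < a i)
    {u : EuclideanSpace ℝ (Fin n)} (hu : u ∈ cornerSimplex n) :
    projScale b⁻¹ a⁻¹ (projScale b a u) = u := by
  have hS := (vertexInterp_pos hb ha hu).ne'
  have h : vertexInterp b⁻¹ a⁻¹ (projScale b a u) = (vertexInterp b a u)⁻¹ := by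
    rw [vertexInterp_eq, one_sub_sum_projScale hS]
    have : ∀ i, projScale b a u i * a⁻¹ i = (vertexInterp b a u)⁻¹ * u i := by
      intro i
      have := (ha i).ne'
      rw [projScale_apply, Pi.inv_apply]
      field_simp
    simp_rw [this, ← Finset.mul_sum]
    field_simp
    ring
  ext i
  have := (ha i).ne'
  rw [projScale_apply, h, projScale_apply, Pi.inv_apply]
  field_simp

lemma injOn_projScale {n : ℕ} {b : ℝ} {a : Fin n → ℝ} (hb : 0 < b) (ha : ∀ i, 0 < a i) :
    Set.InjOn (projScale b a) (cornerSimplex n) :=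
  Set.LeftInvOn.injOn (f₁' := projScale b⁻¹ a⁻¹) fun _ hu => projScale_inv_projScale hb ha hu

lemma image_projScale {n : ℕ} {b : ℝ} {a : Fin n → ℝ} (hb : 0 < b) (ha : ∀ i, 0 < a i) :
    projScale b a '' cornerSimplex n = cornerSimplex n := by
  have ha' : ∀ i, 0 < a⁻¹ i := fun i => inv_pos.2 (ha i)
  refine Set.Subset.antisymm (Set.image_subset_iff.2 fun u hu => projScale_mem hb ha hu) ?_
  intro v hv
  refine ⟨projScale b⁻¹ a⁻¹ v, projScale_mem (inv_pos.2 hb) ha' hv, ?_⟩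
  simpa using projScale_inv_projScale (inv_pos.2 hb) ha' hv

/-- The linear part of `vertexInterp b a`. -/
noncomputable def vertexInterpLinear {n : ℕ} (b : ℝ) (a : Fin n → ℝ) :
    EuclideanSpace ℝ (Fin n) →L[ℝ] ℝ :=
  ∑ i, (a i - b) • EuclideanSpace.proj i

lemma vertexInterpLinear_apply {n : ℕ} (b : ℝ) (a : Fin n → ℝ)
    (u : EuclideanSpace ℝ (Fin n)) :
    vertexInterpLinear b a u = ∑ i, u i * (a i - b) := by
  simp [vertexInterpLinear, mul_comm]

lemma hasFDerivAt_vertexInterp {n : ℕ} (b : ℝ) (a : Fin n → ℝ)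
    (u : EuclideanSpace ℝ (Fin n)) :
    HasFDerivAt (vertexInterp b a) (vertexInterpLinear b a) u := by
  have h : vertexInterp b a = fun u => b + vertexInterpLinear b a u := by
    ext u
    rw [vertexInterpLinear_apply, vertexInterp]
  rw [h]
  exact (vertexInterpLinear b a).hasFDerivAt.const_add b

/-- The derivative of `projScale b a` at `u`. -/
noncomputable def projScaleDeriv {n : ℕ} (b : ℝ) (a : Fin n → ℝ)
    (u : EuclideanSpace ℝ (Fin n)) :
    EuclideanSpace ℝ (Fin n) →L[ℝ] EuclideanSpace ℝ (Fin n) :=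
  LinearMap.toContinuousLinearMap (coordScale a ∘ₗ ((vertexInterp b a u)⁻¹ •
    LinearMap.transvection
      (-(vertexInterp b a u)⁻¹ • (vertexInterpLinear b a).toLinearMap) u))

lemma hasFDerivAt_projScale {n : ℕ} {b : ℝ} {a : Fin n → ℝ} {u : EuclideanSpace ℝ (Fin n)}
    (h : vertexInterp b a u ≠ 0) :
    HasFDerivAt (projScale b a) (projScaleDeriv b a u) u := by
  have h1 := (hasDerivAt_inv h).comp_hasFDerivAt u (hasFDerivAt_vertexInterp b a u)
  have h2 := h1.smul (LinearMap.toContinuousLinearMap (coordScale a)).hasFDerivAt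
  refine h2.congr_fderiv ?_
  ext v i
  simp [projScaleDeriv, LinearMap.transvection.apply, coordScale_apply]
  field_simp

lemma det_projScaleDeriv {n : ℕ} {b : ℝ} {a : Fin n → ℝ} {u : EuclideanSpace ℝ (Fin n)}
    (h : vertexInterp b a u ≠ 0) :
    (projScaleDeriv b a u).det = (b * ∏ i, a i) * (vertexInterp b a u ^ (n + 1))⁻¹ := by
  have h1 : ∑ i, u i * (a i - b) = vertexInterp b a u - b := by rw [vertexInterp]; ring
  rw [projScaleDeriv, LinearMap.det_toContinuousLinearMap, LinearMap.det_comp, det_coordScale,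
    LinearMap.det_smul, LinearMap.transvection.det, finrank_euclideanSpace_fin]
  simp only [LinearMap.smul_apply, ContinuousLinearMap.coe_coe, vertexInterpLinear_apply, h1,
    smul_eq_mul, inv_pow]
  field_simp
  ring

theorem setIntegral_cornerSimplex_inv_vertexInterp_pow {n : ℕ} {b : ℝ} {a : Fin n → ℝ}
    (hb : 0 < b) (ha : ∀ i, 0 < a i) (μ : Measure (EuclideanSpace ℝ (Fin n)))
    [μ.IsAddHaarMeasure] :
    ∫ u in cornerSimplex n, (vertexInterp b a u ^ (n + 1))⁻¹ ∂μ
      = μ.real (cornerSimplex n) / (b * ∏ i, a i) := by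
  have hm := (isClosed_cornerSimplex n).measurableSet
  have hP : 0 < b * ∏ i, a i := mul_pos hb (Finset.prod_pos fun i _ => ha i)
  have key := integral_image_eq_integral_abs_det_fderiv_smul μ hm
    (fun u hu => (hasFDerivAt_projScale (vertexInterp_pos hb ha hu).ne').hasFDerivWithinAt)
    (injOn_projScale hb ha) (fun _ => (1 : ℝ))
  rw [image_projScale hb ha] at key
  have h : ∫ u in cornerSimplex n, |(projScaleDeriv b a u).det| • (1 : ℝ) ∂μ
      = ∫ u in cornerSimplex n, (b * ∏ i, a i) * (vertexInterp b a u ^ (n + 1))⁻¹ ∂μ := by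
    refine setIntegral_congr_fun hm fun u hu => ?_
    have hS := vertexInterp_pos hb ha hu
    simp only [smul_eq_mul, mul_one]
    rw [det_projScaleDeriv hS.ne', abs_of_pos (by positivity)]
  rw [h, integral_const_mul, setIntegral_const, smul_eq_mul, mul_one] at key
  exact (eq_div_iff hP.ne').2 (by rw [key, mul_comm])

/-- The linear map sending the standard basis to the edges of a simplex at its first vertex. -/
noncomputable def edgeMap {E : Type*} [AddCommGroup E] [Module ℝ E] {n : ℕ}
    (y : Fin (n + 1) → E) : EuclideanSpace ℝ (Fin n) →ₗ[ℝ] E :=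
  Fintype.linearCombination ℝ (fun i : Fin n => y i.succ - y 0) ∘ₗ
    (WithLp.linearEquiv 2 ℝ (Fin n → ℝ)).toLinearMap

lemma edgeMap_apply {E : Type*} [AddCommGroup E] [Module ℝ E] {n : ℕ}
    (y : Fin (n + 1) → E) (u : EuclideanSpace ℝ (Fin n)) :
    edgeMap y u = ∑ i, u i • (y i.succ - y 0) := by
  simp [edgeMap, Fintype.linearCombination_apply]

lemma convexHull_range_eq_image_cornerSimplex {E : Type*} [AddCommGroup E] [Module ℝ E] {n : ℕ}
    (y : Fin (n + 1) → E) :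
    convexHull ℝ (Set.range y) = (fun u => y 0 + edgeMap y u) '' cornerSimplex n := by
  have h : convexHull ℝ (Set.range y)
      = Fintype.linearCombination ℝ y '' stdSimplex ℝ (Fin (n + 1)) := by
    rw [← convexHull_rangle_single_eq_stdSimplex, LinearMap.image_convexHull, ← Set.range_comp]
    congr 2
    ext i
    simp [Fintype.linearCombination_apply_single]
  rw [h]
  ext x
  constructor
  · rintro ⟨w, ⟨hw0, hw1⟩, rfl⟩
    rw [Fin.sum_univ_succ] at hw1
    refine ⟨WithLp.toLp 2 fun i => w i.succ, ⟨fun i => hw0 _, ?_⟩, ?_⟩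
    · have := hw0 0
      simp only
      linarith
    · have : w 0 = 1 - ∑ i : Fin n, w i.succ := by linarith
      simp only [edgeMap_apply, Fintype.linearCombination_apply, Fin.sum_univ_succ, this, smul_sub,
        Finset.sum_sub_distrib, sub_smul, one_smul, Finset.sum_smul]
      abel
  · rintro ⟨u, ⟨hu0, hu1⟩, rfl⟩
    refine ⟨Fin.cons (1 - ∑ i, u i) u, ⟨?_, ?_⟩, ?_⟩
    · intro i
      refine Fin.cases ?_ (fun i => ?_) i
      · simpa using hu1
      · simpa using hu0 i
    · simp [Fin.sum_univ_succ]
    · simp only [edgeMap_apply, Fintype.linearCombination_apply, Fin.sum_univ_succ, smul_sub,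
        Finset.sum_sub_distrib, sub_smul, one_smul, Finset.sum_smul, Fin.cons_zero, Fin.cons_succ]
      abel

lemma hausdorffMeasure_image_const_add {U V : Type*} [NormedAddCommGroup U]
    [InnerProductSpace ℝ U] [FiniteDimensional ℝ U] [MeasurableSpace U] [BorelSpace U]
    [NormedAddCommGroup V] [InnerProductSpace ℝ V] [FiniteDimensional ℝ V] [MeasurableSpace V]
    [BorelSpace V] (f : U →ₗ[ℝ] V) (c : V) (s : Set U) :
    μH[finrank ℝ U] ((fun u => c + f u) '' s)
      = ENNReal.ofReal f.normDet * μH[finrank ℝ U] s := by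
  rw [← f.hausdorffMeasure_image s, ← (IsometryEquiv.addLeft c).hausdorffMeasure_image _ (f '' s),
    Set.image_image]
  rfl

lemma restrict_hausdorffMeasure_image_const_add {U V : Type*} [NormedAddCommGroup U]
    [InnerProductSpace ℝ U] [FiniteDimensional ℝ U] [MeasurableSpace U] [BorelSpace U]
    [NormedAddCommGroup V] [InnerProductSpace ℝ V] [FiniteDimensional ℝ V] [MeasurableSpace V]
    [BorelSpace V] (f : U →ₗ[ℝ] V) (c : V) (s : Set U) :
    (μH[finrank ℝ U] : Measure V).restrict ((fun u => c + f u) '' s)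
      = ENNReal.ofReal f.normDet •
        ((μH[finrank ℝ U] : Measure U).restrict s).map (fun u => c + f u) := by
  have hc : Continuous fun u => c + f u :=
    continuous_const.add f.continuous_of_finiteDimensional
  ext A hA
  rw [Measure.restrict_apply hA, Measure.smul_apply, Measure.map_apply hc.measurable hA,
    Measure.restrict_apply (hc.measurable hA), smul_eq_mul, ← hausdorffMeasure_image_const_add f c,
    Set.image_preimage_inter]

/-- For a `(d−1)`-dimensional simplex `F = conv{y_1, …, y_d} ⊆ ℝ^d`
(the `y_k` affinely independent) and any `t ∈ ℝ^d` with `⟨y_k, t⟩ < 1` for every vertex,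
`∫_F (1 − ⟨x, t⟩)^{−d} dH^{d−1}(x) = H^{d−1}(F) / ∏_{k} (1 − ⟨y_k, t⟩)`,
where `H^{d−1}` is the `(d−1)`-dimensional Hausdorff measure on Euclidean `ℝ^d`. -/
theorem stmt_7 (d : ℕ) (y : Fin d → EuclideanSpace ℝ (Fin d))
    (hy : AffineIndependent ℝ y)
    (t : EuclideanSpace ℝ (Fin d)) (ht : ∀ k, ∑ i, y k i * t i < 1) :
    ∫ p in convexHull ℝ (Set.range y), ((1 - ∑ i, p i * t i) ^ d)⁻¹ ∂(μH[(d : ℝ) - 1])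
      = (μH[(d : ℝ) - 1] (convexHull ℝ (Set.range y))).toReal
          / ∏ k, (1 - ∑ i, y k i * t i) := by
  rcases d with _ | n
  · simp
  have hdim : ((n + 1 : ℕ) : ℝ) - 1 = (finrank ℝ (EuclideanSpace ℝ (Fin n)) : ℕ) := by simp
  have hcont : Continuous fun u => y 0 + edgeMap y u :=
    continuous_const.add (edgeMap y).continuous_of_finiteDimensional
  have hval : ∀ u, 1 - ∑ i, (y 0 + edgeMap y u) i * t i
      = vertexInterp (1 - ∑ i, y 0 i * t i) (fun k => 1 - ∑ i, y k.succ i * t i) u := by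
    intro u
    have h (x : EuclideanSpace ℝ (Fin (n + 1))) : ∑ i, x i * t i = inner ℝ t x := by
      simp [PiLp.inner_apply]
    simp only [h, vertexInterp, edgeMap_apply, inner_add_right, inner_sum, inner_smul_right,
      inner_sub_right]
    rw [sub_add_eq_sub_sub, sub_eq_add_neg, ← Finset.sum_neg_distrib]
    congr 1
    exact Finset.sum_congr rfl fun i _ => by ring
  rw [hdim, convexHull_range_eq_image_cornerSimplex, restrict_hausdorffMeasure_image_const_add,
    integral_smul_measure, integral_map hcont.aemeasurable
      (Measurable.aestronglyMeasurable (by fun_prop)), hausdorffMeasure_image_const_add]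
  simp only [hval]
  rw [setIntegral_cornerSimplex_inv_vertexInterp_pow (sub_pos.2 (ht 0))
    (fun k => sub_pos.2 (ht k.succ)), Fin.prod_univ_succ, ENNReal.toReal_mul, smul_eq_mul,
    Measure.real, mul_div_assoc]
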